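/- Let V be an arithmetical variety with the congruence extension property such that V_FSI is a universal class. If every doubly injective span in V_FSI has a strong amalgam in V, then V has the strong amalgamation property. -/

import Mathlib

open FirstOrder Language Set

universe u

namespace Transfer

variable (L : FirstOrder.Language.{u, u})

/-- A bundled `L`-structure with carrier in universe `u`. -/
structure Struc : Type (u + 1) where
  Carrier : Type u
  [str : L.Structure Carrier]

attribute [instance] Struc.str

/-- Product structure on a Pi type. -/
instance piStructure {ι : Type u} (M : ι → Type u) [∀ i, L.Structure (M i)] :
    L.Structure (∀ i, M i) where
  funMap f x i := Structure.funMap f fun j => x j i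
  RelMap r x := ∀ i, Structure.RelMap r fun j => x j i

/-- Product structure on a binary product. -/
instance prodStructure (M N : Type u) [L.Structure M] [L.Structure N] :
    L.Structure (M × N) where
  funMap f x := (Structure.funMap f fun j => (x j).1, Structure.funMap f fun j => (x j).2)
  RelMap r x := Structure.RelMap r (fun j => (x j).1) ∧ Structure.RelMap r (fun j => (x j).2)

variable {L}

/-- The bundled structure on a substructure. -/
abbrev ofSub (B : Struc L) (S : L.Substructure B.Carrier) : Struc L := ⟨S⟩

/-- The kernel of a map, as a set of pairs. -/
def kerSet {α β : Type u} (f : α → β) : Set (α × α) := {p | f p.1 = f p.2}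

/-- The restriction of a binary relation on `B` to a substructure `S`. -/
def restrict {B : Struc L} (S : L.Substructure B.Carrier)
    (Θ : Set (B.Carrier × B.Carrier)) : Set ((ofSub B S).Carrier × (ofSub B S).Carrier) :=
  {p | ((p.1 : B.Carrier), (p.2 : B.Carrier)) ∈ Θ}

/-- The image of a binary relation on a substructure `S` in `B`. -/
def lift {B : Struc L} (S : L.Substructure B.Carrier)
    (Θ : Set ((ofSub B S).Carrier × (ofSub B S).Carrier)) : Set (B.Carrier × B.Carrier) :=
  (fun p => ((p.1 : B.Carrier), (p.2 : B.Carrier))) '' Θ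

/-- The set of `Q`-congruences of `A`: kernels of homomorphisms into members of `Q`. -/
def ConQ (Q : Set (Struc L)) (A : Struc L) : Set (Set (A.Carrier × A.Carrier)) :=
  {θ | ∃ M ∈ Q, ∃ f : A.Carrier →[L] M.Carrier, θ = kerSet f}

/-- The least `Q`-congruence of `A` containing `R`. -/
def cgQ (Q : Set (Struc L)) (A : Struc L) (R : Set (A.Carrier × A.Carrier)) :
    Set (A.Carrier × A.Carrier) :=
  ⋂₀ {θ | θ ∈ ConQ Q A ∧ R ⊆ θ}

/-- The join of two `Q`-congruences in `Con_Q A`. -/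
def joinQ (Q : Set (Struc L)) (A : Struc L) (θ φ : Set (A.Carrier × A.Carrier)) :
    Set (A.Carrier × A.Carrier) :=
  cgQ Q A (θ ∪ φ)

/-- `θ` is a meet-irreducible element of `Con_Q A`. -/
def MeetIrred (Q : Set (Struc L)) (A : Struc L) (θ : Set (A.Carrier × A.Carrier)) : Prop :=
  θ ∈ ConQ Q A ∧
    ∀ θ₁ ∈ ConQ Q A, ∀ θ₂ ∈ ConQ Q A, θ = θ₁ ∩ θ₂ → θ = θ₁ ∨ θ = θ₂

/-- `θ` is a completely meet-irreducible element of `Con_Q A`. -/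
def CompletelyMeetIrred (Q : Set (Struc L)) (A : Struc L)
    (θ : Set (A.Carrier × A.Carrier)) : Prop :=
  θ ∈ ConQ Q A ∧
    ∀ S ⊆ ConQ Q A, θ = ⋂₀ S → θ ∈ S

/-- The class of relatively finitely subdirectly irreducible members of `Q`. -/
def RFSI (Q : Set (Struc L)) : Set (Struc L) :=
  {A | A ∈ Q ∧ MeetIrred Q A (Set.diagonal A.Carrier)}

/-- The class of relatively subdirectly irreducible members of `Q`. -/
def RSI (Q : Set (Struc L)) : Set (Struc L) :=
  {A | A ∈ Q ∧ CompletelyMeetIrred Q A (Set.diagonal A.Carrier)}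

/-- `B` has the `Q`-congruence extension property. -/
def HasQCEP (Q : Set (Struc L)) (B : Struc L) : Prop :=
  ∀ S : L.Substructure B.Carrier, ∀ θ ∈ ConQ Q (ofSub B S),
    ∃ Φ ∈ ConQ Q B, restrict S Φ = θ

/-- A class `K` of members of `Q` has the `Q`-congruence extension property. -/
def ClassQCEP (Q K : Set (Struc L)) : Prop :=
  ∀ B ∈ K, HasQCEP Q B

variable (L)

/-- `Q` is a quasivariety: closed under isomorphisms, substructures, direct products,
and ultraproducts. -/
def IsQuasivariety (Q : Set (Struc L)) : Prop :=
  (∀ A ∈ Q, ∀ B : Struc L, Nonempty (A.Carrier ≃[L] B.Carrier) → B ∈ Q) ∧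
  (∀ B ∈ Q, ∀ S : L.Substructure B.Carrier, ofSub B S ∈ Q) ∧
  (∀ (ι : Type u) (f : ι → Struc L), (∀ i, f i ∈ Q) →
    (⟨∀ i, (f i).Carrier⟩ : Struc L) ∈ Q) ∧
  (∀ (ι : Type u) (f : ι → Struc L) (U : Ultrafilter ι), (∀ i, f i ∈ Q) →
    (⟨(U : Filter ι).Product fun i => (f i).Carrier⟩ : Struc L) ∈ Q)

/-- `V` is a variety: closed under homomorphic images, substructures, and direct products. -/
def IsVariety (V : Set (Struc L)) : Prop :=
  (∀ A ∈ V, ∀ B : Struc L, ∀ f : A.Carrier →[L] B.Carrier, Function.Surjective f → B ∈ V) ∧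
  (∀ B ∈ V, ∀ S : L.Substructure B.Carrier, ofSub B S ∈ V) ∧
  (∀ (ι : Type u) (f : ι → Struc L), (∀ i, f i ∈ V) →
    (⟨∀ i, (f i).Carrier⟩ : Struc L) ∈ V)

variable {L}

/-- `Q` is relatively congruence-distributive: `Con_Q A` is a distributive lattice
for every `A ∈ Q`. -/
def RelCongDist (Q : Set (Struc L)) : Prop :=
  ∀ A ∈ Q, ∀ θ ∈ ConQ Q A, ∀ φ ∈ ConQ Q A, ∀ ψ ∈ ConQ Q A,
    θ ∩ joinQ Q A φ ψ = joinQ Q A (θ ∩ φ) (θ ∩ ψ)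

/-- Relation composition `Θ ∘ Φ = {(a,c) : ∃ b, (a,b) ∈ Φ ∧ (b,c) ∈ Θ}`. -/
def relComp {α : Type u} (Θ Φ : Set (α × α)) : Set (α × α) :=
  {p | ∃ b, (p.1, b) ∈ Φ ∧ (b, p.2) ∈ Θ}

/-- `Q` is relatively congruence-permutable. -/
def RelCongPerm (Q : Set (Struc L)) : Prop :=
  ∀ A ∈ Q, ∀ θ ∈ ConQ Q A, ∀ φ ∈ ConQ Q A, relComp θ φ = relComp φ θ

/-- A class `K` is closed under substructures. -/
def SubClosed (K : Set (Struc L)) : Prop :=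
  ∀ B ∈ K, ∀ S : L.Substructure B.Carrier, ofSub B S ∈ K

/-- A class `K` is closed under isomorphisms. -/
def IsoClosed (K : Set (Struc L)) : Prop :=
  ∀ A ∈ K, ∀ B : Struc L, Nonempty (A.Carrier ≃[L] B.Carrier) → B ∈ K

/-- A universal class: closed under isomorphisms, substructures, and ultraproducts. -/
def IsUniversalClass (K : Set (Struc L)) : Prop :=
  IsoClosed K ∧ SubClosed K ∧
  (∀ (ι : Type u) (f : ι → Struc L) (U : Ultrafilter ι), (∀ i, f i ∈ K) →
    (⟨(U : Filter ι).Product fun i => (f i).Carrier⟩ : Struc L) ∈ K)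

/-- The extension property for a class `K`. -/
def HasEP (K : Set (Struc L)) : Prop :=
  ∀ A ∈ K, ∀ B ∈ K, ∀ C ∈ K,
    ∀ (φB : A.Carrier →[L] B.Carrier) (φC : A.Carrier →[L] C.Carrier),
      Function.Injective φB → Function.Surjective φC →
      ∃ D ∈ K, ∃ (ψB : B.Carrier →[L] D.Carrier) (ψC : C.Carrier →[L] D.Carrier),
        Function.Injective ψC ∧ ∀ a, ψB (φB a) = ψC (φC a)

/-- The one-sided amalgamation property for a class `K`. -/
def Has1AP (K : Set (Struc L)) : Prop :=
  ∀ A ∈ K, ∀ B ∈ K, ∀ C ∈ K,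
    ∀ (φB : A.Carrier →[L] B.Carrier) (φC : A.Carrier →[L] C.Carrier),
      Function.Injective φB → Function.Injective φC →
      ∃ D ∈ K, ∃ (ψB : B.Carrier →[L] D.Carrier) (ψC : C.Carrier →[L] D.Carrier),
        Function.Injective ψC ∧ ∀ a, ψB (φB a) = ψC (φC a)

/-- Every doubly injective span in `K` has an amalgam in `K'`. -/
def HasAmalgamIn (K K' : Set (Struc L)) : Prop :=
  ∀ A ∈ K, ∀ B ∈ K, ∀ C ∈ K,
    ∀ (φB : A.Carrier →[L] B.Carrier) (φC : A.Carrier →[L] C.Carrier),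
      Function.Injective φB → Function.Injective φC →
      ∃ D ∈ K', ∃ (ψB : B.Carrier →[L] D.Carrier) (ψC : C.Carrier →[L] D.Carrier),
        Function.Injective ψB ∧ Function.Injective ψC ∧ ∀ a, ψB (φB a) = ψC (φC a)

/-- The amalgamation property for a class `K`. -/
def HasAP (K : Set (Struc L)) : Prop := HasAmalgamIn K K

/-- The transferable injections property for a class `K`. -/
def HasTIP (K : Set (Struc L)) : Prop :=
  ∀ A ∈ K, ∀ B ∈ K, ∀ C ∈ K,
    ∀ (φB : A.Carrier →[L] B.Carrier) (φC : A.Carrier →[L] C.Carrier),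
      Function.Injective φB →
      ∃ D ∈ K, ∃ (ψB : B.Carrier →[L] D.Carrier) (ψC : C.Carrier →[L] D.Carrier),
        Function.Injective ψC ∧ ∀ a, ψB (φB a) = ψC (φC a)

/-- Every doubly injective span in `K` has a strong amalgam in `K'`. -/
def HasStrongAmalgamIn (K K' : Set (Struc L)) : Prop :=
  ∀ A ∈ K, ∀ B ∈ K, ∀ C ∈ K,
    ∀ (φB : A.Carrier →[L] B.Carrier) (φC : A.Carrier →[L] C.Carrier),
      Function.Injective φB → Function.Injective φC →
      ∃ D ∈ K', ∃ (ψB : B.Carrier →[L] D.Carrier) (ψC : C.Carrier →[L] D.Carrier),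
        Function.Injective ψB ∧ Function.Injective ψC ∧ (∀ a, ψB (φB a) = ψC (φC a)) ∧
        Set.range (fun a => ψB (φB a)) = Set.range ψB ∩ Set.range ψC

/-- The strong amalgamation property for a class `K`. -/
def HasSAP (K : Set (Struc L)) : Prop := HasStrongAmalgamIn K K

/-- `φ : A → B` is an epimorphism in the class `K`. -/
def IsEpiIn (K : Set (Struc L)) {A B : Struc L} (φ : A.Carrier →[L] B.Carrier) : Prop :=
  ∀ C ∈ K, ∀ ψ₁ ψ₂ : B.Carrier →[L] C.Carrier,
    ψ₁.comp φ = ψ₂.comp φ → ψ₁ = ψ₂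

/-- The class `K` has surjective epimorphisms. -/
def HasSE (K : Set (Struc L)) : Prop :=
  ∀ A ∈ K, ∀ B ∈ K, ∀ φ : A.Carrier →[L] B.Carrier,
    IsEpiIn K φ → Function.Surjective φ

/-- A substructure `S` of `B` is a retract of `B`. -/
def IsRetract (B : Struc L) (S : L.Substructure B.Carrier) : Prop :=
  ∃ ψ : B.Carrier →[L] (ofSub B S).Carrier, ∀ a : (ofSub B S).Carrier, ψ (a : B.Carrier) = a


/-- The smallest variety containing `V₁ ∪ V₂`. -/
def varJoin (L : FirstOrder.Language.{u, u}) (V₁ V₂ : Set (Struc L)) : Set (Struc L) :=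
  ⋂₀ {W | IsVariety L W ∧ V₁ ⊆ W ∧ V₂ ⊆ W}

/-- A congruence of `A`: an equivalence relation compatible with the operations. -/
structure IsCong (A : Struc L) (θ : Set (A.Carrier × A.Carrier)) : Prop where
  refl : ∀ a, (a, a) ∈ θ
  symm : ∀ {a b}, (a, b) ∈ θ → (b, a) ∈ θ
  trans : ∀ {a b c}, (a, b) ∈ θ → (b, c) ∈ θ → (a, c) ∈ θ
  map : ∀ {n} (f : L.Functions n) (x y : Fin n → A.Carrier),
    (∀ i, (x i, y i) ∈ θ) → (Structure.funMap f x, Structure.funMap f y) ∈ θ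

/-- The inverse image of a binary relation under a homomorphism. -/
def pull {A B : Struc L} (φ : A.Carrier →[L] B.Carrier)
    (Θ : Set (B.Carrier × B.Carrier)) : Set (A.Carrier × A.Carrier) :=
  {p | (φ p.1, φ p.2) ∈ Θ}

theorem isCong_kerSet {A B : Struc L} (f : A.Carrier →[L] B.Carrier) : IsCong A (kerSet f) where
  refl _ := rfl
  symm h := Eq.symm h
  trans h h' := Eq.trans h h'
  map g x y h := by
    change f _ = f _
    rw [f.map_fun, f.map_fun]
    exact congrArg _ (funext h)

theorem isCong_of_mem_ConQ {K : Set (Struc L)} {A : Struc L}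
    {θ : Set (A.Carrier × A.Carrier)} : θ ∈ ConQ K A → IsCong A θ :=
  fun ⟨_, _, f, hf⟩ => hf ▸ isCong_kerSet f

theorem IsCong.pull {A B : Struc L} (φ : A.Carrier →[L] B.Carrier)
    {θ : Set (B.Carrier × B.Carrier)} (h : IsCong B θ) : IsCong A (pull φ θ) where
  refl _ := h.refl _
  symm h' := h.symm h'
  trans h₁ h₂ := h.trans h₁ h₂
  map g x y h' := by
    change (φ _, φ _) ∈ θ
    rw [φ.map_fun, φ.map_fun]
    exact h.map g _ _ h'

theorem IsCong.inter {A : Struc L} {θ φ : Set (A.Carrier × A.Carrier)} (hθ : IsCong A θ)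
    (hφ : IsCong A φ) : IsCong A (θ ∩ φ) where
  refl a := ⟨hθ.refl a, hφ.refl a⟩
  symm h := ⟨hθ.symm h.1, hφ.symm h.2⟩
  trans h h' := ⟨hθ.trans h.1 h'.1, hφ.trans h.2 h'.2⟩
  map f x y h := ⟨hθ.map f x y fun i => (h i).1, hφ.map f x y fun i => (h i).2⟩

theorem IsCong.sInter {A : Struc L} {S : Set (Set (A.Carrier × A.Carrier))}
    (h : ∀ θ ∈ S, IsCong A θ) : IsCong A (⋂₀ S) where
  refl a θ hθ := (h θ hθ).refl a
  symm h' θ hθ := (h θ hθ).symm (h' θ hθ)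
  trans h₁ h₂ θ hθ := (h θ hθ).trans (h₁ θ hθ) (h₂ θ hθ)
  map f x y h' θ hθ := (h θ hθ).map f x y fun i => h' i θ hθ

theorem IsCong.iInter {A : Struc L} {ι : Type*} {θ : ι → Set (A.Carrier × A.Carrier)}
    (h : ∀ i, IsCong A (θ i)) : IsCong A (⋂ i, θ i) :=
  IsCong.sInter (by rintro _ ⟨i, rfl⟩; exact h i)

theorem isCong_diagonal (A : Struc L) : IsCong A (Set.diagonal A.Carrier) :=
  isCong_kerSet (Hom.id L A.Carrier)

theorem IsCong.sUnion {A : Struc L} {c : Set (Set (A.Carrier × A.Carrier))}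
    (h : ∀ θ ∈ c, IsCong A θ) (hc : IsChain (· ⊆ ·) c) (hne : c.Nonempty) :
    IsCong A (⋃₀ c) where
  refl a := let ⟨θ, hθ⟩ := hne; ⟨θ, hθ, (h θ hθ).refl a⟩
  symm := fun ⟨θ, hθ, h'⟩ => ⟨θ, hθ, (h θ hθ).symm h'⟩
  trans := by
    rintro a b d ⟨θ, hθ, h₁⟩ ⟨φ, hφ, h₂⟩
    rcases hc.total hθ hφ with hle | hle
    · exact ⟨φ, hφ, (h φ hφ).trans (hle h₁) h₂⟩
    · exact ⟨θ, hθ, (h θ hθ).trans h₁ (hle h₂)⟩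
  map := by
    intro n f x y h'
    choose t ht hxy using h'
    have := hne.to_subtype
    obtain ⟨⟨z, hz⟩, hle⟩ := (directedOn_iff_directed.1 hc.directedOn).finite_le
      fun i => (⟨t i, ht i⟩ : c)
    exact ⟨z, hz, (h z hz).map f x y fun i => hle i (hxy i)⟩

/-- A congruence extends to one that is maximal among those with the same trace on `R`. -/
theorem IsCong.exists_maximal {A : Struc L} {θ : Set (A.Carrier × A.Carrier)}
    (h : IsCong A θ) (R : Set (A.Carrier × A.Carrier)) :
    ∃ Φ, θ ⊆ Φ ∧ Maximal (fun Ψ => IsCong A Ψ ∧ Ψ ∩ R ⊆ θ) Φ := by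
  refine zorn_subset_nonempty {Ψ | IsCong A Ψ ∧ Ψ ∩ R ⊆ θ} ?_ θ ⟨h, Set.inter_subset_left⟩
  intro c hc hchain hne
  refine ⟨⋃₀ c, ⟨IsCong.sUnion (fun ψ hψ => (hc hψ).1) hchain hne, ?_⟩,
    fun s hs => Set.subset_sUnion_of_mem hs⟩
  rintro p ⟨⟨ψ, hψ, hp⟩, hR⟩
  exact (hc hψ).2 ⟨hp, hR⟩

/-- The setoid of a congruence. -/
def IsCong.setoid {A : Struc L} {θ : Set (A.Carrier × A.Carrier)} (h : IsCong A θ) :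
    Setoid A.Carrier where
  r a b := (a, b) ∈ θ
  iseqv := ⟨h.refl, h.symm, h.trans⟩

/-- The quotient of a structure by a congruence, with empty relations. -/
noncomputable def IsCong.quotient {A : Struc L} {θ : Set (A.Carrier × A.Carrier)}
    (h : IsCong A θ) : Struc L where
  Carrier := Quotient h.setoid
  str :=
    { funMap := fun f x => Quotient.mk _ (Structure.funMap f fun i => (x i).out)
      RelMap := fun _ _ => False }

/-- The canonical projection onto the quotient by a congruence. -/
noncomputable def IsCong.proj [L.IsAlgebraic] {A : Struc L} {θ : Set (A.Carrier × A.Carrier)}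
    (h : IsCong A θ) : A.Carrier →[L] h.quotient.Carrier where
  toFun a := Quotient.mk h.setoid a
  map_fun' f x := Quotient.sound (s := h.setoid) <|
    h.map f _ _ fun i => h.symm (Quotient.mk_out (s := h.setoid) (x i))
  map_rel' r := isEmptyElim r

theorem IsCong.proj_surjective [L.IsAlgebraic] {A : Struc L} {θ : Set (A.Carrier × A.Carrier)}
    (h : IsCong A θ) : Function.Surjective h.proj :=
  fun q => Quotient.exists_rep (s := h.setoid) q

theorem IsCong.kerSet_proj [L.IsAlgebraic] {A : Struc L} {θ : Set (A.Carrier × A.Carrier)}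
    (h : IsCong A θ) : kerSet h.proj = θ :=
  Set.ext fun _ => Quotient.eq (r := h.setoid)

theorem mem_ConQ_iff [L.IsAlgebraic] {V : Set (Struc L)} (hV : IsVariety L V) {A : Struc L}
    (hA : A ∈ V) {θ : Set (A.Carrier × A.Carrier)} : θ ∈ ConQ V A ↔ IsCong A θ := by
  constructor
  · exact isCong_of_mem_ConQ
  · intro h
    exact ⟨_, hV.1 A hA _ h.proj h.proj_surjective, h.proj, h.kerSet_proj.symm⟩

theorem pull_mem_ConQ {K : Set (Struc L)} {A B : Struc L} (φ : A.Carrier →[L] B.Carrier)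
    {Θ : Set (B.Carrier × B.Carrier)} (h : Θ ∈ ConQ K B) : pull φ Θ ∈ ConQ K A := by
  obtain ⟨M, hM, f, rfl⟩ := h
  exact ⟨M, hM, f.comp φ, rfl⟩

/-- The corestriction of a homomorphism to its range. -/
def toRange {A M : Struc L} (f : A.Carrier →[L] M.Carrier) :
    A.Carrier →[L] (ofSub M f.range).Carrier :=
  f.codRestrict f.range fun a => ⟨a, rfl⟩

theorem toRange_surjective {A M : Struc L} (f : A.Carrier →[L] M.Carrier) :
    Function.Surjective (toRange f) := by
  rintro ⟨_, a, rfl⟩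
  exact ⟨a, rfl⟩

theorem kerSet_toRange {A M : Struc L} (f : A.Carrier →[L] M.Carrier) :
    kerSet (toRange f) = kerSet f :=
  Set.ext fun _ => Subtype.ext_iff

theorem exists_surjective_of_mem_ConQ {K : Set (Struc L)} (hK : SubClosed K) {A : Struc L}
    {θ : Set (A.Carrier × A.Carrier)} (h : θ ∈ ConQ K A) :
    ∃ M ∈ K, ∃ f : A.Carrier →[L] M.Carrier, Function.Surjective f ∧ θ = kerSet f := by
  obtain ⟨M, hM, f, rfl⟩ := h
  exact ⟨_, hK M hM f.range, toRange f, toRange_surjective f, (kerSet_toRange f).symm⟩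

/-- A homomorphism factors through any surjective homomorphism with smaller kernel. -/
theorem exists_factor [L.IsAlgebraic] {A P M : Struc L} (q : A.Carrier →[L] P.Carrier)
    (hq : Function.Surjective q) (f : A.Carrier →[L] M.Carrier) (h : kerSet q ⊆ kerSet f) :
    ∃ g : P.Carrier →[L] M.Carrier, ∀ a, g (q a) = f a := by
  have key : ∀ a b, q a = q b → f a = f b := fun a b hab => h (show (a, b) ∈ kerSet q from hab)
  have hs := Function.surjInv_eq hq
  refine ⟨⟨fun p => f (Function.surjInv hq p), fun {n} F x => ?_, fun {n} r => isEmptyElim r⟩,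
    fun a => key _ _ (hs _)⟩
  change f _ = Structure.funMap F (f ∘ fun i => Function.surjInv hq (x i))
  rw [← f.map_fun]
  refine key _ _ ?_
  rw [hs, q.map_fun]
  exact congrArg _ (funext fun i => (hs (x i)).symm)

section Irreducible

variable [L.IsAlgebraic] {V : Set (Struc L)}

theorem MeetIrred.mem_ConQ_RFSI (hV : IsVariety L V) {A : Struc L} (hA : A ∈ V)
    {θ : Set (A.Carrier × A.Carrier)} (h : MeetIrred V A θ) : θ ∈ ConQ (RFSI V) A := by
  have hc := (mem_ConQ_iff hV hA).1 h.1
  have hQ : hc.quotient ∈ V := hV.1 A hA _ hc.proj hc.proj_surjective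
  refine ⟨hc.quotient, ⟨hQ, (mem_ConQ_iff hV hQ).2 (isCong_diagonal _), ?_⟩, hc.proj,
    hc.kerSet_proj.symm⟩
  have hdiag : pull hc.proj (Set.diagonal _) = θ := hc.kerSet_proj
  have hinj : ∀ ψ, θ = pull hc.proj ψ → Set.diagonal _ = ψ := by
    intro ψ hψ
    ext ⟨x, y⟩
    obtain ⟨a, rfl⟩ := hc.proj_surjective x
    obtain ⟨b, rfl⟩ := hc.proj_surjective y
    change (a, b) ∈ pull hc.proj (Set.diagonal _) ↔ (a, b) ∈ pull hc.proj ψ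
    rw [hdiag, ← hψ]
  intro θ₁ h₁ θ₂ h₂ heq
  exact (h.2 _ (pull_mem_ConQ hc.proj h₁) _ (pull_mem_ConQ hc.proj h₂)
    (hdiag.symm.trans (congrArg (pull hc.proj) heq))).imp (hinj _) (hinj _)

theorem univ_mem_ConQ_RFSI (hV : IsVariety L V) {A : Struc L} (hA : A ∈ V) :
    Set.univ ∈ ConQ (RFSI V) A := by
  have hc : IsCong A Set.univ := by constructor <;> intros <;> trivial
  refine MeetIrred.mem_ConQ_RFSI hV hA ⟨(mem_ConQ_iff hV hA).2 hc, fun θ₁ _ θ₂ _ heq => ?_⟩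
  exact Or.inl (Set.univ_subset_iff.1 (heq.le.trans Set.inter_subset_left)).symm

theorem meetIrred_of_mem_ConQ_RFSI (hV : IsVariety L V) (hsub : SubClosed (RFSI V))
    {A : Struc L} (hA : A ∈ V) {θ : Set (A.Carrier × A.Carrier)}
    (h : θ ∈ ConQ (RFSI V) A) : MeetIrred V A θ := by
  obtain ⟨M, hM, f, hf, rfl⟩ := exists_surjective_of_mem_ConQ hsub h
  refine ⟨⟨M, hM.1, f, rfl⟩, ?_⟩
  have push : ∀ ψ ∈ ConQ V A, kerSet f ⊆ ψ → ∃ ψ' ∈ ConQ V M, pull f ψ' = ψ := by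
    intro ψ hψ hle
    have hc := (mem_ConQ_iff hV hA).1 hψ
    obtain ⟨g, hg⟩ := exists_factor f hf hc.proj (hle.trans hc.kerSet_proj.ge)
    refine ⟨kerSet g, (mem_ConQ_iff hV hM.1).2 (isCong_kerSet g), ?_⟩
    refine Eq.trans ?_ hc.kerSet_proj
    ext ⟨a, b⟩
    change g (f a) = g (f b) ↔ hc.proj a = hc.proj b
    rw [hg, hg]
  intro θ₁ h₁ θ₂ h₂ heq
  obtain ⟨ψ₁, hψ₁, rfl⟩ := push θ₁ h₁ (heq ▸ Set.inter_subset_left)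
  obtain ⟨ψ₂, hψ₂, rfl⟩ := push θ₂ h₂ (heq ▸ Set.inter_subset_right)
  have : Set.diagonal M.Carrier = ψ₁ ∩ ψ₂ := by
    ext ⟨x, y⟩
    obtain ⟨a, rfl⟩ := hf x
    obtain ⟨b, rfl⟩ := hf y
    change (a, b) ∈ kerSet f ↔ (a, b) ∈ pull f ψ₁ ∩ pull f ψ₂
    rw [heq]
  rcases hM.2.2 _ hψ₁ _ hψ₂ this with h | h
  · exact Or.inl (h ▸ rfl)
  · exact Or.inr (h ▸ rfl)

theorem subset_of_mem_ConQ_RFSI (hV : IsVariety L V) (hsub : SubClosed (RFSI V))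
    {A : Struc L} (hA : A ∈ V) {θ θ₁ θ₂ : Set (A.Carrier × A.Carrier)}
    (h : θ ∈ ConQ (RFSI V) A) (h₁ : IsCong A θ₁) (h₂ : IsCong A θ₂) (heq : θ = θ₁ ∩ θ₂) :
    θ = θ₁ ∨ θ = θ₂ :=
  (meetIrred_of_mem_ConQ_RFSI hV hsub hA h).2 _ ((mem_ConQ_iff hV hA).2 h₁) _
    ((mem_ConQ_iff hV hA).2 h₂) heq

/-- A pair outside a congruence is also outside a meet-irreducible congruence above it. -/
theorem IsCong.exists_irreducible (hV : IsVariety L V) {A : Struc L} (hA : A ∈ V)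
    {θ : Set (A.Carrier × A.Carrier)} (h : IsCong A θ) {p : A.Carrier × A.Carrier}
    (hp : p ∉ θ) : ∃ Φ ∈ ConQ (RFSI V) A, θ ⊆ Φ ∧ p ∉ Φ := by
  obtain ⟨Φ, hle, ⟨hc, htr⟩, hmax⟩ := h.exists_maximal {p}
  have hpΦ : p ∉ Φ := fun hpΦ => hp (htr ⟨hpΦ, rfl⟩)
  refine ⟨Φ, MeetIrred.mem_ConQ_RFSI hV hA ⟨(mem_ConQ_iff hV hA).2 hc, ?_⟩, hle, hpΦ⟩
  intro θ₁ h₁ θ₂ h₂ heq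
  have aux : ∀ ψ ∈ ConQ V A, Φ ⊆ ψ → p ∉ ψ → Φ = ψ := fun ψ hψ hs hpψ =>
    hs.antisymm (hmax ⟨(mem_ConQ_iff hV hA).1 hψ,
      by rintro _ ⟨hq, rfl⟩; exact absurd hq hpψ⟩ hs)
  by_cases hp₁ : p ∈ θ₁
  · exact Or.inr (aux θ₂ h₂ (heq ▸ Set.inter_subset_right) fun hp₂ => hpΦ (heq ▸ ⟨hp₁, hp₂⟩))
  · exact Or.inl (aux θ₁ h₁ (heq ▸ Set.inter_subset_left) hp₁)

/-- Under the congruence extension property, `α` extends along `φ` to a congruence above any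
given congruence whose inverse image lies below `α`. -/
theorem exists_extension (hV : IsVariety L V) (hcep : ClassQCEP V V) {A B : Struc L}
    (hA : A ∈ V) (hB : B ∈ V) (φ : A.Carrier →[L] B.Carrier)
    {α : Set (A.Carrier × A.Carrier)} (hα : IsCong A α)
    {θ : Set (B.Carrier × B.Carrier)} (hθ : IsCong B θ) (hle : pull φ θ ⊆ α) :
    ∃ Θ, IsCong B Θ ∧ θ ⊆ Θ ∧ pull φ Θ = α := by
  have hM : hθ.quotient ∈ V := hV.1 B hB _ hθ.proj hθ.proj_surjective
  have hK : hα.quotient ∈ V := hV.1 A hA _ hα.proj hα.proj_surjective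
  let f := hθ.proj.comp φ
  have hker : kerSet (toRange f) = pull φ θ := by
    rw [kerSet_toRange, ← congrArg (pull φ) hθ.kerSet_proj]
    rfl
  obtain ⟨g, hg⟩ := exists_factor (toRange f) (toRange_surjective f) hα.proj
    (hker.le.trans (hle.trans hα.kerSet_proj.ge))
  obtain ⟨Φ, hΦ, hres⟩ := hcep _ hM f.range (kerSet g) ⟨_, hK, g, rfl⟩
  have hΦc := (mem_ConQ_iff hV hM).1 hΦ
  refine ⟨pull hθ.proj Φ, hΦc.pull _, ?_, ?_⟩
  · rintro ⟨x, y⟩ hxy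
    have : hθ.proj x = hθ.proj y := hθ.kerSet_proj.ge hxy
    change (hθ.proj x, hθ.proj y) ∈ Φ
    rw [this]
    exact hΦc.refl _
  · rw [← hα.kerSet_proj]
    ext ⟨x, y⟩
    change (toRange f x, toRange f y) ∈ restrict f.range Φ ↔ hα.proj x = hα.proj y
    rw [hres, ← hg, ← hg]
    rfl

theorem exists_irreducible_extension (hV : IsVariety L V) (hcep : ClassQCEP V V)
    (hsub : SubClosed (RFSI V)) {A B : Struc L} (hA : A ∈ V) (hB : B ∈ V)
    (φ : A.Carrier →[L] B.Carrier) {α : Set (A.Carrier × A.Carrier)}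
    (hα : α ∈ ConQ (RFSI V) A) {θ : Set (B.Carrier × B.Carrier)} (hθ : IsCong B θ)
    (hle : pull φ θ ⊆ α) :
    ∃ Θ ∈ ConQ (RFSI V) B, θ ⊆ Θ ∧ pull φ Θ = α := by
  have hαc : IsCong A α := isCong_of_mem_ConQ hα
  obtain ⟨Θ₀, hc₀, hle₀, rfl⟩ := exists_extension hV hcep hA hB φ hαc hθ hle
  obtain ⟨Θ, hle₁, ⟨hc, htr⟩, hmax⟩ := hc₀.exists_maximal {p | ∃ a b, p = (φ a, φ b)}
  have hpull : pull φ Θ = pull φ Θ₀ :=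
    Set.Subset.antisymm (fun ⟨a, b⟩ hp => htr ⟨hp, a, b, rfl⟩) fun _ hp => hle₁ hp
  refine ⟨Θ, MeetIrred.mem_ConQ_RFSI hV hB ⟨(mem_ConQ_iff hV hB).2 hc, ?_⟩,
    hle₀.trans hle₁, hpull⟩
  intro θ₁ h₁ θ₂ h₂ heq
  have aux : ∀ ψ ∈ ConQ V B, Θ ⊆ ψ → pull φ Θ₀ = pull φ ψ → Θ = ψ := fun ψ hψ hs hψΘ =>
    hs.antisymm (hmax ⟨(mem_ConQ_iff hV hB).1 hψ, by
      rintro _ ⟨hq, a, b, rfl⟩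
      exact hψΘ.ge (show (a, b) ∈ pull φ ψ from hq)⟩ hs)
  exact (subset_of_mem_ConQ_RFSI hV hsub hA hα
    (((mem_ConQ_iff hV hB).1 h₁).pull φ) (((mem_ConQ_iff hV hB).1 h₂).pull φ)
    (by rw [← hpull, heq]; rfl)).imp
    (aux θ₁ h₁ (heq ▸ Set.inter_subset_left)) (aux θ₂ h₂ (heq ▸ Set.inter_subset_right))

end Irreducible

section Arithmetical

variable [L.IsAlgebraic] {V : Set (Struc L)}

theorem isCong_relComp (hV : IsVariety L V) (hp : RelCongPerm V) {A : Struc L} (hA : A ∈ V)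
    {θ φ : Set (A.Carrier × A.Carrier)} (hθ : IsCong A θ) (hφ : IsCong A φ) :
    IsCong A (relComp θ φ) := by
  have hperm := hp A hA _ ((mem_ConQ_iff hV hA).2 hθ) _ ((mem_ConQ_iff hV hA).2 hφ)
  constructor
  · exact fun a => ⟨a, hφ.refl a, hθ.refl a⟩
  · rintro a b ⟨c, h₁, h₂⟩
    rw [hperm]
    exact ⟨c, hθ.symm h₂, hφ.symm h₁⟩
  · rintro a b d ⟨x, h₁, h₂⟩ ⟨y, h₃, h₄⟩
    have hxy : (x, y) ∈ relComp θ φ := by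
      rw [hperm]
      exact ⟨b, h₂, h₃⟩
    obtain ⟨z, h₅, h₆⟩ := hxy
    exact ⟨z, hφ.trans h₁ h₅, hθ.trans h₆ h₄⟩
  · intro n f x y h
    choose z h₁ h₂ using h
    exact ⟨Structure.funMap f z, hφ.map f _ _ h₁, hθ.map f _ _ h₂⟩

theorem joinQ_eq_relComp (hV : IsVariety L V) (hp : RelCongPerm V) {A : Struc L} (hA : A ∈ V)
    {θ φ : Set (A.Carrier × A.Carrier)} (hθ : IsCong A θ) (hφ : IsCong A φ) :
    joinQ V A θ φ = relComp θ φ := by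
  apply Set.Subset.antisymm
  · refine Set.sInter_subset_of_mem
      ⟨(mem_ConQ_iff hV hA).2 (isCong_relComp hV hp hA hθ hφ), ?_⟩
    rintro ⟨a, b⟩ (h | h)
    · exact ⟨a, hφ.refl a, h⟩
    · exact ⟨b, h, hθ.refl b⟩
  · rintro ⟨a, b⟩ ⟨c, h₁, h₂⟩ ψ ⟨hψ, hle⟩
    exact ((mem_ConQ_iff hV hA).1 hψ).trans (hle (Or.inr h₁)) (hle (Or.inl h₂))

theorem inter_relComp (hV : IsVariety L V) (hd : RelCongDist V) (hp : RelCongPerm V)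
    {A : Struc L} (hA : A ∈ V) {θ φ ψ : Set (A.Carrier × A.Carrier)} (hθ : IsCong A θ)
    (hφ : IsCong A φ) (hψ : IsCong A ψ) :
    θ ∩ relComp φ ψ = relComp (θ ∩ φ) (θ ∩ ψ) := by
  rw [← joinQ_eq_relComp hV hp hA hφ hψ,
    ← joinQ_eq_relComp hV hp hA (hθ.inter hφ) (hθ.inter hψ)]
  exact hd A hA _ ((mem_ConQ_iff hV hA).2 hθ) _ ((mem_ConQ_iff hV hA).2 hφ) _
    ((mem_ConQ_iff hV hA).2 hψ)

theorem relComp_inter_relComp_subset (hV : IsVariety L V) (hd : RelCongDist V)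
    (hp : RelCongPerm V) {A : Struc L} (hA : A ∈ V) {θ φ ψ : Set (A.Carrier × A.Carrier)}
    (hθ : IsCong A θ) (hφ : IsCong A φ) (hψ : IsCong A ψ) :
    relComp θ ψ ∩ relComp φ ψ ⊆ relComp (θ ∩ φ) ψ := by
  rw [inter_relComp hV hd hp hA (isCong_relComp hV hp hA hθ hψ) hφ hψ]
  rintro ⟨a, b⟩ ⟨c, ⟨-, h₁⟩, h₂⟩
  rw [Set.inter_comm, inter_relComp hV hd hp hA hφ hθ hψ] at h₂
  obtain ⟨d, ⟨-, h₃⟩, h₄⟩ := h₂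
  exact ⟨d, hψ.trans h₁ h₃, h₄.2, h₄.1⟩

theorem mem_relComp_iInter (hV : IsVariety L V) (hd : RelCongDist V) (hp : RelCongPerm V)
    {A : Struc L} (hA : A ∈ V) {ι : Type*} {θ : ι → Set (A.Carrier × A.Carrier)}
    (hθ : ∀ i, IsCong A (θ i)) {ψ : Set (A.Carrier × A.Carrier)} (hψ : IsCong A ψ)
    {x y : A.Carrier} (F : Finset ι) (h : ∀ i ∈ F, (x, y) ∈ relComp (θ i) ψ) :
    ∃ z, (x, z) ∈ ψ ∧ ∀ i ∈ F, (z, y) ∈ θ i := by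
  classical
  induction F using Finset.induction_on with
  | empty => exact ⟨x, hψ.refl x, by simp⟩
  | insert j F hj ih =>
    obtain ⟨z, hz, hz'⟩ := ih fun i hi => h i (Finset.mem_insert_of_mem hi)
    have hF : IsCong A (⋂ i : F, θ i) := IsCong.iInter fun i => hθ i
    obtain ⟨w, hw, hw'⟩ := relComp_inter_relComp_subset hV hd hp hA (hθ j) hF hψ
      ⟨h j (Finset.mem_insert_self j F), z, hz, Set.mem_iInter.2 fun i => hz' i i.2⟩
    refine ⟨w, hw, fun i hi => ?_⟩
    rcases Finset.mem_insert.1 hi with rfl | hi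
    · exact hw'.1
    · exact Set.mem_iInter.1 hw'.2 ⟨i, hi⟩

/-- The Chinese remainder theorem for arithmetical varieties. -/
theorem chinese_remainder (hV : IsVariety L V) (hd : RelCongDist V) (hp : RelCongPerm V)
    {A : Struc L} (hA : A ∈ V) [Nonempty A.Carrier] {ι : Type*}
    {θ : ι → Set (A.Carrier × A.Carrier)} (hθ : ∀ i, IsCong A (θ i)) (a : ι → A.Carrier)
    (F : Finset ι) (h : ∀ i ∈ F, ∀ j ∈ F, (a i, a j) ∈ relComp (θ i) (θ j)) :
    ∃ x, ∀ i ∈ F, (x, a i) ∈ θ i := by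
  classical
  induction F using Finset.induction_on with
  | empty => exact ⟨Classical.arbitrary _, by simp⟩
  | insert j F hj ih =>
    obtain ⟨x, hx⟩ := ih fun i hi k hk =>
      h i (Finset.mem_insert_of_mem hi) k (Finset.mem_insert_of_mem hk)
    obtain ⟨z, hz, hz'⟩ := mem_relComp_iInter hV hd hp hA hθ (hθ j) (x := a j) (y := x) F
      fun i hi => by
        obtain ⟨w, hw, hw'⟩ := (isCong_relComp hV hp hA (hθ i) (hθ j)).symm
          (h i (Finset.mem_insert_of_mem hi) j (Finset.mem_insert_self j F))
        exact ⟨w, hw, (hθ i).trans hw' ((hθ i).symm (hx i hi))⟩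
    refine ⟨z, fun i hi => ?_⟩
    rcases Finset.mem_insert.1 hi with rfl | hi
    · exact (hθ _).symm hz
    · exact (hθ i).trans (hz' i hi) (hx i hi)

end Arithmetical

section Compactness

variable [L.IsAlgebraic]

/-- The homomorphism into an ultraproduct given by a family of homomorphisms. -/
def toUltraproduct {ι : Type u} (U : Ultrafilter ι) {A : Struc L} (M : ι → Struc L)
    (f : ∀ i, A.Carrier →[L] (M i).Carrier) :
    A.Carrier →[L] (U : Filter ι).Product fun i => (M i).Carrier where
  toFun a := ((fun i => f i a : ∀ i, (M i).Carrier) : (U : Filter ι).Product _)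
  map_fun' F x := by
    refine Eq.trans ?_ (Ultraproduct.funMap_cast F fun j i => f i (x j)).symm
    congr 1
    funext i
    exact (f i).map_fun F x
  map_rel' r := isEmptyElim r

theorem toUltraproduct_eq_iff {ι : Type u} (U : Ultrafilter ι) {A : Struc L} (M : ι → Struc L)
    (f : ∀ i, A.Carrier →[L] (M i).Carrier) (a b : A.Carrier) :
    toUltraproduct U M f a = toUltraproduct U M f b ↔ ∀ᶠ i in U, f i a = f i b :=
  Quotient.eq''

/-- The limit along an ultrafilter of kernels of homomorphisms into `K` is again one. -/
theorem exists_ultralimit {K : Set (Struc L)} (hK : IsUniversalClass K) {ι : Type u}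
    (U : Ultrafilter ι) {A : Struc L} {θ : ι → Set (A.Carrier × A.Carrier)}
    (h : ∀ i, θ i ∈ ConQ K A) :
    {p | ∀ᶠ i in U, p ∈ θ i} ∈ ConQ K A := by
  choose M hM f hf using h
  refine ⟨_, hK.2.2 ι M U hM, toUltraproduct U M f, ?_⟩
  ext ⟨a, b⟩
  change _ ↔ toUltraproduct U M f a = toUltraproduct U M f b
  rw [toUltraproduct_eq_iff]
  simp only [hf]
  rfl

/-- Compactness: if for every compatible pair of `K`-congruences some element of `A` witnesses
that `b` and `c` are identified, then finitely many elements of `A` suffice. -/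
theorem exists_finset_witnesses {K : Set (Struc L)} (hK : IsUniversalClass K)
    {A B C : Struc L} (φB : A.Carrier →[L] B.Carrier) (φC : A.Carrier →[L] C.Carrier)
    {b : B.Carrier} {c : C.Carrier}
    (h : ∀ Θ ∈ ConQ K B, ∀ Φ ∈ ConQ K C, pull φB Θ = pull φC Φ →
      ∃ a, (b, φB a) ∈ Θ ∧ (c, φC a) ∈ Φ) :
    ∃ F : Finset A.Carrier, ∀ Θ ∈ ConQ K B, ∀ Φ ∈ ConQ K C, pull φB Θ = pull φC Φ →
      ∃ a ∈ F, (b, φB a) ∈ Θ ∧ (c, φC a) ∈ Φ := by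
  classical
  by_contra! hcon
  choose Θ hΘ Φ hΦ hcomp hF using hcon
  let U : Ultrafilter (Finset A.Carrier) := Ultrafilter.of Filter.atTop
  obtain ⟨a, hb, hc⟩ := h _ (exists_ultralimit hK U hΘ) _ (exists_ultralimit hK U hΦ) (by
    ext ⟨x, y⟩
    refine Filter.eventually_congr (Filter.Eventually.of_forall fun F => ?_)
    exact Set.ext_iff.1 (hcomp F) (x, y))
  have ha : ∀ᶠ F in (U : Filter (Finset A.Carrier)), a ∈ F :=
    Ultrafilter.of_le _ ((Filter.eventually_ge_atTop {a}).mono fun F hF =>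
      Finset.singleton_subset_iff.1 hF)
  obtain ⟨F, haF, hbF, hcF⟩ := (ha.and (Filter.Eventually.and hb hc)).exists
  exact hF F a haF hbF hcF

end Compactness

section StrongAmalgamation

variable [L.IsAlgebraic] {V : Set (Struc L)}

/-- In an embedded span, every pair of distinct elements of `B` is separated by a compatible
pair of meet-irreducible congruences. -/
theorem exists_compatible_pair (hV : IsVariety L V) (hcep : ClassQCEP V V)
    (hsub : SubClosed (RFSI V)) {A B C : Struc L} (hA : A ∈ V) (hB : B ∈ V) (hC : C ∈ V)
    (φB : A.Carrier →[L] B.Carrier) {φC : A.Carrier →[L] C.Carrier}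
    (hφC : Function.Injective φC) {b b' : B.Carrier} (hne : b ≠ b') :
    ∃ Θ ∈ ConQ (RFSI V) B, ∃ Φ ∈ ConQ (RFSI V) C, pull φB Θ = pull φC Φ ∧ (b, b') ∉ Θ := by
  obtain ⟨Θ, hΘ, -, hb⟩ := (isCong_diagonal B).exists_irreducible hV hB (p := (b, b')) hne
  have hΘc : IsCong B Θ := isCong_of_mem_ConQ hΘ
  obtain ⟨Φ, hΦ, -, hΦΘ⟩ := exists_irreducible_extension hV hcep hsub hA hC φC
    (pull_mem_ConQ φB hΘ) (isCong_diagonal C) (by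
      rintro ⟨x, y⟩ hxy
      obtain rfl : x = y := hφC hxy
      exact hΘc.refl _)
  exact ⟨Θ, hΘ, Φ, hΦ, hΦΘ.symm, hb⟩

theorem exists_common_element (hV : IsVariety L V) (hd : RelCongDist V) (hp : RelCongPerm V)
    (hcep : ClassQCEP V V) (hu : IsUniversalClass (RFSI V)) {A B C : Struc L} (hA : A ∈ V)
    (hB : B ∈ V) (hC : C ∈ V) {φB : A.Carrier →[L] B.Carrier} {φC : A.Carrier →[L] C.Carrier}
    (hφC : Function.Injective φC) {b : B.Carrier} {c : C.Carrier}
    (h : ∀ Θ ∈ ConQ (RFSI V) B, ∀ Φ ∈ ConQ (RFSI V) C, pull φB Θ = pull φC Φ →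
      ∃ a, (b, φB a) ∈ Θ ∧ (c, φC a) ∈ Φ) :
    ∃ a, φB a = b := by
  obtain ⟨F, hF⟩ := exists_finset_witnesses hu φB φC h
  -- the meets of the compatible pairs for which `a` is a witness
  let S : A.Carrier → Set (Set (B.Carrier × B.Carrier) × Set (C.Carrier × C.Carrier)) :=
    fun a => {p | p.1 ∈ ConQ (RFSI V) B ∧ p.2 ∈ ConQ (RFSI V) C ∧
      pull φB p.1 = pull φC p.2 ∧ (b, φB a) ∈ p.1 ∧ (c, φC a) ∈ p.2}
  let β : A.Carrier → Set (B.Carrier × B.Carrier) := fun a => ⋂ p : S a, p.1.1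
  let γ : A.Carrier → Set (C.Carrier × C.Carrier) := fun a => ⋂ p : S a, p.1.2
  have hβ : ∀ a, IsCong B (β a) := fun a => IsCong.iInter fun p => isCong_of_mem_ConQ p.2.1
  have hγ : ∀ a, IsCong C (γ a) := fun a => IsCong.iInter fun p => isCong_of_mem_ConQ p.2.2.1
  have hbβ : ∀ a, (b, φB a) ∈ β a := fun a => Set.mem_iInter.2 fun p => p.2.2.2.2.1
  have hcγ : ∀ a, (c, φC a) ∈ γ a := fun a => Set.mem_iInter.2 fun p => p.2.2.2.2.2
  have hβγ : ∀ a, pull φB (β a) = pull φC (γ a) := by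
    intro a
    ext ⟨x, y⟩
    change (φB x, φB y) ∈ β a ↔ (φC x, φC y) ∈ γ a
    rw [Set.mem_iInter, Set.mem_iInter]
    exact forall_congr' fun p => Set.ext_iff.1 p.2.2.2.1 (x, y)
  have hjoin : ∀ i j, (i, j) ∈ relComp (pull φB (β i)) (pull φB (β j)) := by
    intro i j
    by_contra hij
    have hi := (hβ i).pull φB
    have hj := (hβ j).pull φB
    obtain ⟨α, hα, hle, hnot⟩ :=
      (isCong_relComp hV hp hA hi hj).exists_irreducible hV hA hij
    have hle_i : pull φB (β i) ⊆ α := fun ⟨x, y⟩ hxy => hle ⟨x, hj.refl x, hxy⟩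
    have hle_j : pull φC (γ j) ⊆ α := fun ⟨x, y⟩ hxy =>
      hle ⟨y, (hβγ j).ge hxy, hi.refl y⟩
    obtain ⟨Θ, hΘ, hiΘ, rfl⟩ :=
      exists_irreducible_extension hV hcep hu.2.1 hA hB φB hα (hβ i) hle_i
    obtain ⟨Φ, hΦ, hjΦ, hΦΘ⟩ :=
      exists_irreducible_extension hV hcep hu.2.1 hA hC φC hα (hγ j) hle_j
    obtain ⟨a, hba, hca⟩ := h Θ hΘ Φ hΦ hΦΘ.symm
    have h₁ : (i, a) ∈ pull φB Θ :=
      (isCong_of_mem_ConQ hΘ).trans ((isCong_of_mem_ConQ hΘ).symm (hiΘ (hbβ i))) hba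
    have h₂ : (a, j) ∈ pull φC Φ :=
      (isCong_of_mem_ConQ hΦ).trans ((isCong_of_mem_ConQ hΦ).symm hca) (hjΦ (hcγ j))
    exact hnot ((isCong_of_mem_ConQ hα).trans h₁ (hΦΘ.le h₂))
  obtain ⟨a₀, -⟩ := h _ (univ_mem_ConQ_RFSI hV hB) _ (univ_mem_ConQ_RFSI hV hC) rfl
  have : Nonempty A.Carrier := ⟨a₀⟩
  obtain ⟨x, hx⟩ := chinese_remainder hV hd hp hA (fun a => (hβ a).pull φB) id F
    fun i _ j _ => hjoin i j
  refine ⟨x, Eq.symm ?_⟩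
  by_contra hne
  obtain ⟨Θ, hΘ, Φ, hΦ, hcomp, hnot⟩ :=
    exists_compatible_pair hV hcep hu.2.1 hA hB hC φB hφC hne
  obtain ⟨a, haF, hba, hca⟩ := hF Θ hΘ Φ hΦ hcomp
  have hle : β a ⊆ Θ := Set.iInter_subset (fun p : S a => p.1.1)
    ⟨(Θ, Φ), hΘ, hΦ, hcomp, hba, hca⟩
  exact hnot ((isCong_of_mem_ConQ hΘ).trans hba ((isCong_of_mem_ConQ hΘ).symm (hle (hx a haF))))

/-- A compatible pair of congruences with irreducible quotients is realized by a strong amalgam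
of the quotients. -/
theorem exists_amalgam_of_compatible {K : Set (Struc L)} (hsub : SubClosed K)
    (hK : HasStrongAmalgamIn K V) {A B C : Struc L} (φB : A.Carrier →[L] B.Carrier)
    (φC : A.Carrier →[L] C.Carrier) {Θ : Set (B.Carrier × B.Carrier)}
    {Φ : Set (C.Carrier × C.Carrier)} (hΘ : Θ ∈ ConQ K B) (hΦ : Φ ∈ ConQ K C)
    (hcomp : pull φB Θ = pull φC Φ) :
    ∃ D ∈ V, ∃ (ψB : B.Carrier →[L] D.Carrier) (ψC : C.Carrier →[L] D.Carrier),
      kerSet ψB = Θ ∧ kerSet ψC = Φ ∧ (∀ a, ψB (φB a) = ψC (φC a)) ∧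
      ∀ b c, ψB b = ψC c → ∃ a, (b, φB a) ∈ Θ ∧ (c, φC a) ∈ Φ := by
  obtain ⟨M, hM, f, hf, rfl⟩ := exists_surjective_of_mem_ConQ hsub hΘ
  obtain ⟨N, hN, g, hg, rfl⟩ := exists_surjective_of_mem_ConQ hsub hΦ
  obtain ⟨P, hP, q, hq, hqker⟩ :=
    exists_surjective_of_mem_ConQ hsub (pull_mem_ConQ φB hΘ)
  obtain ⟨k, hk⟩ := exists_factor q hq (f.comp φB) hqker.ge
  obtain ⟨l, hl⟩ := exists_factor q hq (g.comp φC) (hqker.ge.trans hcomp.le)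
  have hkinj : Function.Injective k := by
    intro x y hxy
    obtain ⟨a, rfl⟩ := hq x
    obtain ⟨a', rfl⟩ := hq y
    rw [hk, hk] at hxy
    exact hqker.le (show (a, a') ∈ pull φB (kerSet f) from hxy)
  have hlinj : Function.Injective l := by
    intro x y hxy
    obtain ⟨a, rfl⟩ := hq x
    obtain ⟨a', rfl⟩ := hq y
    rw [hl, hl] at hxy
    exact hqker.le (hcomp.ge (show (a, a') ∈ pull φC (kerSet g) from hxy))
  obtain ⟨D, hD, χB, χC, hχB, hχC, hcomm, hstrong⟩ := hK P hP M hM N hN k l hkinj hlinj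
  refine ⟨D, hD, χB.comp f, χC.comp g, ?_, ?_, fun a => ?_, fun b c hbc => ?_⟩
  · exact Set.ext fun _ => hχB.eq_iff
  · exact Set.ext fun _ => hχC.eq_iff
  · have := hcomm (q a)
    rw [hk, hl] at this
    exact this
  · obtain ⟨p, hpb⟩ := hstrong.ge ⟨⟨f b, rfl⟩, g c, hbc.symm⟩
    obtain ⟨a, rfl⟩ := hq p
    have hpc : χC (l (q a)) = χC (g c) := (hcomm (q a)).symm.trans (hpb.trans hbc)
    refine ⟨a, ?_, ?_⟩
    · exact (hχB hpb).symm.trans (hk a)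
    · exact (hχC hpc).symm.trans (hl a)

end StrongAmalgamation

/-- The homomorphism into a product given by a family of homomorphisms. -/
def toPi {ι : Type u} {A : Struc L} (M : ι → Struc L)
    (f : ∀ i, A.Carrier →[L] (M i).Carrier) : A.Carrier →[L] ∀ i, (M i).Carrier where
  toFun a i := f i a
  map_fun' F x := funext fun i => (f i).map_fun F x
  map_rel' r x h i := (f i).map_rel r x h

/-- Theorem 4.7: an arithmetical variety with the CEP whose FSI members form a
universal class has the SAP provided every doubly injective span in `V_FSI` has a strong
amalgam in `V`. -/
theorem stmt19 (L : FirstOrder.Language.{u, u}) [L.IsAlgebraic]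
    (V : Set (Struc L)) (hV : IsVariety L V)
    (hd : RelCongDist V) (hp : RelCongPerm V)
    (hcep : ClassQCEP V V)
    (hu : IsUniversalClass (RFSI V))
    (h : HasStrongAmalgamIn (RFSI V) V) :
    HasSAP V := by
  intro A hA B hB C hC φB φC hφB hφC
  let I : Type u := {p : Set (B.Carrier × B.Carrier) × Set (C.Carrier × C.Carrier) //
    p.1 ∈ ConQ (RFSI V) B ∧ p.2 ∈ ConQ (RFSI V) C ∧ pull φB p.1 = pull φC p.2}
  choose D hD ψB ψC hkB hkC hcomm hstrong using fun p : I =>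
    exists_amalgam_of_compatible hu.2.1 h φB φC p.2.1 p.2.2.1 p.2.2.2
  refine ⟨⟨∀ i, (D i).Carrier⟩, hV.2.2 I D hD, toPi D ψB, toPi D ψC, fun b b' hbb => ?_,
    fun c c' hcc => ?_, fun a => funext fun i => hcomm i a, Set.Subset.antisymm ?_ ?_⟩
  · by_contra hne
    obtain ⟨Θ, hΘ, Φ, hΦ, hcomp, hnot⟩ :=
      exists_compatible_pair hV hcep hu.2.1 hA hB hC φB hφC hne
    exact hnot ((hkB ⟨(Θ, Φ), hΘ, hΦ, hcomp⟩).le (congrFun hbb ⟨(Θ, Φ), hΘ, hΦ, hcomp⟩))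
  · by_contra hne
    obtain ⟨Φ, hΦ, Θ, hΘ, hcomp, hnot⟩ :=
      exists_compatible_pair hV hcep hu.2.1 hA hC hB φC hφB hne
    exact hnot ((hkC ⟨(Θ, Φ), hΘ, hΦ, hcomp.symm⟩).le
      (congrFun hcc ⟨(Θ, Φ), hΘ, hΦ, hcomp.symm⟩))
  · rintro _ ⟨a, rfl⟩
    exact ⟨⟨φB a, rfl⟩, φC a, funext fun i => (hcomm i a).symm⟩
  · rintro _ ⟨⟨b, rfl⟩, c, hbc⟩
    obtain ⟨a, rfl⟩ := exists_common_element hV hd hp hcep hu hA hB hC hφC (b := b) (c := c)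
      fun Θ hΘ Φ hΦ hcomp =>
        hstrong ⟨(Θ, Φ), hΘ, hΦ, hcomp⟩ b c (congrFun hbc ⟨(Θ, Φ), hΘ, hΦ, hcomp⟩).symm
    exact ⟨a, rfl⟩

end Transfer
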